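/- Let g : V(Ψ_{1,m,√m/2}) → V(T) be a non-contractive embedding of the unit-weighted tree Ψ_{1,m,√m/2} into a metric tree T of pathwidth one. Then the average stretch over edges satisfies (1/|E(Ψ_{1,m,√m/2})|) · Σ_{{u,v} ∈ E(Ψ_{1,m,√m/2})} d_T(g(u), g(v)) ≥ √m / 2^{10}. -/

import Mathlib

open scoped BigOperators

/-- A path decomposition of `G` with `t` bags. -/
def IsPathDecomp {V : Type*} (G : SimpleGraph V) (t : ℕ) (X : Fin t → Finset V) : Prop :=
  (∀ v : V, ∃ i, v ∈ X i) ∧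
  (∀ ⦃u v : V⦄, G.Adj u v → ∃ i, u ∈ X i ∧ v ∈ X i) ∧
  (∀ (v : V) (i j l : Fin t), i ≤ j → j ≤ l → v ∈ X i → v ∈ X l → v ∈ X j)

/-- The pathwidth of `G` is at most `k`. -/
def pathwidthLE {V : Type*} (G : SimpleGraph V) (k : ℕ) : Prop :=
  ∃ (t : ℕ) (X : Fin t → Finset V), IsPathDecomp G t X ∧ ∀ i, (X i).card ≤ k + 1

/-- The pathwidth of `G`. -/
noncomputable def pathwidth {V : Type*} (G : SimpleGraph V) : ℕ :=
  sInf {k | pathwidthLE G k}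
/-- Shortest-path (pseudo)metric of the metric graph `(G, len)`. -/
noncomputable def spDist {V : Type*} (G : SimpleGraph V) (len : Sym2 V → ℝ) (u v : V) : ℝ :=
  sInf (Set.range fun w : G.Walk u v => (w.edges.map len).sum)
/-- `sc m = ⌈√m⌉`. -/
noncomputable def sc (m : ℝ) : ℕ := ⌈Real.sqrt m⌉₊

/-- Non-root vertices of the tree `Ψ_{i,m,l}` with `l` top-level legs: `Ψ_{i,m}` consists of a
copy of the spider `Φ_{⌈√m⌉}` (a root with `⌈√m⌉` legs, each a path with `⌈√m⌉` edges) with a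
copy of `Ψ_{i-1,√m}` rooted at each of its leaves.  `Sum.inl (j, p)` is the `p`-th vertex on
the `j`-th leg; `Sum.inr (j, c)` is a non-root vertex of the copy of `Ψ_{i-1,√m}` hanging at
the leaf of leg `j`. -/
noncomputable def PsiC : ℕ → ℝ → ℕ → Type
  | 0, _, _ => Empty
  | (i + 1), m, l =>
      (Fin l × Fin (sc m)) ⊕ (Fin l × PsiC i (Real.sqrt m) (sc (Real.sqrt m)))

/-- The adjacency relation of the tree `Ψ_{i,m,l}`; `none` is the root. -/
noncomputable def PsiRel : (i : ℕ) → (m : ℝ) → (l : ℕ) →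
    Option (PsiC i m l) → Option (PsiC i m l) → Prop
  | 0, _, _, _, _ => False
  | (i + 1), m, l, x, y =>
      match x, y with
      | none, some (Sum.inl (_, p)) => (p : ℕ) = 0
      | some (Sum.inl (j, p)), some (Sum.inl (j', p')) =>
          j = j' ∧ (p : ℕ) + 1 = (p' : ℕ)
      | some (Sum.inl (j, p)), some (Sum.inr (j', c)) =>
          j = j' ∧ (p : ℕ) + 1 = sc m ∧
            PsiRel i (Real.sqrt m) (sc (Real.sqrt m)) none (some c)
      | some (Sum.inr (j, c)), some (Sum.inr (j', c')) =>
          j = j' ∧ PsiRel i (Real.sqrt m) (sc (Real.sqrt m)) (some c) (some c')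
      | _, _ => False

/-- The unit-weighted tree `Ψ_{i,m,l}` (`Ψ_{i,m} = PsiGraph i m (sc m)`, and
`Ψ_{i,m,ℓ} = PsiGraph i m ⌈ℓ⌉` keeps only `⌈ℓ⌉` of the root's legs). -/
noncomputable def PsiGraph (i : ℕ) (m : ℝ) (l : ℕ) : SimpleGraph (Option (PsiC i m l)) :=
  SimpleGraph.fromRel (PsiRel i m l)
noncomputable instance PsiC.instFintype : ∀ (i : ℕ) (m : ℝ) (l : ℕ), Fintype (PsiC i m l)
  | 0, _, _ => inferInstanceAs (Fintype Empty)
  | (i + 1), m, l =>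
      haveI := PsiC.instFintype i (Real.sqrt m) (sc (Real.sqrt m))
      inferInstanceAs
        (Fintype ((Fin l × Fin (sc m)) ⊕ (Fin l × PsiC i (Real.sqrt m) (sc (Real.sqrt m)))))
open scoped Classical in
/-- Sum of (a symmetric function) `f` over the edges of `G`: each unordered edge is counted
once. -/
noncomputable def edgeSum {V : Type*} [Fintype V] (G : SimpleGraph V) (f : V → V → ℝ) : ℝ :=
  (∑ u, ∑ v, if G.Adj u v then f u v else 0) / 2

open scoped Classical in
/-- The number of edges of `G`, as a real number. -/
noncomputable def numEdges {V : Type*} [Fintype V] (G : SimpleGraph V) : ℝ :=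
  (∑ u, ∑ v, if G.Adj u v then (1 : ℝ) else 0) / 2

section MetricTree

variable {V : Type*} {G : SimpleGraph V} {len : Sym2 V → ℝ}

lemma walk_weight_nonneg (hlen : ∀ e, 0 ≤ len e) {u v : V} (w : G.Walk u v) :
    0 ≤ (w.edges.map len).sum :=
  List.sum_nonneg (by simp only [List.mem_map]; rintro _ ⟨e, -, rfl⟩; exact hlen e)

lemma spDist_le_walk (hlen : ∀ e, 0 ≤ len e) {u v : V} (w : G.Walk u v) :
    spDist G len u v ≤ (w.edges.map len).sum :=
  csInf_le ⟨0, by rintro _ ⟨w, rfl⟩; exact walk_weight_nonneg hlen w⟩ ⟨w, rfl⟩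

lemma le_spDist (hG : G.Connected) {u v : V} {c : ℝ}
    (h : ∀ w : G.Walk u v, c ≤ (w.edges.map len).sum) : c ≤ spDist G len u v := by
  obtain ⟨w⟩ := hG u v
  exact le_csInf ⟨_, w, rfl⟩ (by rintro _ ⟨w, rfl⟩; exact h w)

lemma spDist_nonneg (hlen : ∀ e, 0 ≤ len e) (u v : V) : 0 ≤ spDist G len u v :=
  Real.sInf_nonneg (by rintro _ ⟨w, rfl⟩; exact walk_weight_nonneg hlen w)

lemma spDist_self (hlen : ∀ e, 0 ≤ len e) (u : V) : spDist G len u u = 0 :=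
  le_antisymm (by simpa using spDist_le_walk hlen (SimpleGraph.Walk.nil : G.Walk u u))
    (spDist_nonneg hlen u u)

lemma spDist_comm (hG : G.Connected) (hlen : ∀ e, 0 ≤ len e) (u v : V) :
    spDist G len u v = spDist G len v u := by
  have key : ∀ u v : V, spDist G len u v ≤ spDist G len v u := fun u v =>
    le_spDist hG fun w => by simpa using spDist_le_walk hlen w.reverse
  exact le_antisymm (key u v) (key v u)

lemma spDist_triangle (hG : G.Connected) (hlen : ∀ e, 0 ≤ len e) (u v w : V) :
    spDist G len u w ≤ spDist G len u v + spDist G len v w := by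
  rw [← sub_le_iff_le_add]
  refine le_spDist hG fun p => ?_
  rw [sub_le_comm]
  refine le_spDist hG fun q => ?_
  rw [sub_le_iff_le_add']
  simpa using spDist_le_walk hlen (p.append q)

lemma spDist_le_of_adj (hlen : ∀ e, 0 ≤ len e) {u v : V} (h : G.Adj u v) :
    spDist G len u v ≤ len s(u, v) := by
  simpa using spDist_le_walk hlen h.toWalk

lemma abs_sub_le_spDist (hG : G.Connected) {f : V → ℝ}
    (hf : ∀ u v, G.Adj u v → |f u - f v| ≤ len s(u, v)) (u v : V) :
    |f u - f v| ≤ spDist G len u v := by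
  refine le_spDist hG fun w => ?_
  induction w with
  | nil => simp
  | cons h p ih =>
    have := abs_sub_le (f _) (f _) (f _) |>.trans (add_le_add (hf _ _ h) ih)
    simpa using this

lemma spDist_eq_of_isPath (hG : G.IsTree) (hlen : ∀ e, 0 ≤ len e) {u v : V}
    {p : G.Walk u v} (hp : p.IsPath) : spDist G len u v = (p.edges.map len).sum := by
  classical
  refine le_antisymm (spDist_le_walk hlen p) (le_spDist hG.1 fun w => ?_)
  have hpw : p = w.bypass :=
    congrArg Subtype.val ((hG.isAcyclic.subsingleton_path _ _).elim ⟨p, hp⟩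
      ⟨w.bypass, w.bypass_isPath⟩)
  rw [hpw]
  exact (w.edges_bypass_sublist_edges.map len).sum_le_sum
    (by simp only [List.mem_map]; rintro _ ⟨e, -, rfl⟩; exact hlen e)

lemma spDist_add_le_of_mem_support (hG : G.IsTree) (hlen : ∀ e, 0 ≤ len e) {u v x : V}
    {p : G.Walk u v} (hp : p.IsPath) (hx : x ∈ p.support) :
    spDist G len u x + spDist G len x v ≤ spDist G len u v := by
  classical
  rw [spDist_eq_of_isPath hG hlen hp, ← p.take_spec hx]
  rw [SimpleGraph.Walk.edges_append, List.map_append, List.sum_append]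
  exact add_le_add (spDist_le_walk hlen (p.takeUntil x hx))
    (spDist_le_walk hlen (p.dropUntil x hx))

lemma spDist_le_abs_sub_of_mem_support (hG : G.IsTree) (hlen : ∀ e, 0 ≤ len e) {a b x y : V}
    {p : G.Walk a b} (hp : p.IsPath) (hx : x ∈ p.support) (hy : y ∈ p.support) :
    spDist G len x y ≤ |spDist G len a x - spDist G len a y| := by
  classical
  have hy' := hy
  rw [← p.take_spec hx, SimpleGraph.Walk.mem_support_append_iff] at hy'
  obtain h | h := hy'
  · have := spDist_add_le_of_mem_support hG hlen (hp.takeUntil hx) h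
    rw [spDist_comm hG.1 hlen x y]
    exact le_trans (by linarith) (le_abs_self _)
  · have hq : ((p.takeUntil x hx).append ((p.dropUntil x hx).takeUntil y h)).IsPath := by
      refine SimpleGraph.Walk.IsPath.of_append_left (q := (p.dropUntil x hx).dropUntil y h) ?_
      rw [← SimpleGraph.Walk.append_assoc, SimpleGraph.Walk.take_spec,
        SimpleGraph.Walk.take_spec]
      exact hp
    have := spDist_add_le_of_mem_support hG hlen hq (x := x) (by simp)
    rw [abs_sub_comm]
    exact le_trans (by linarith) (le_abs_self _)

end MetricTree

section Caterpillar

variable {V : Type*} {G : SimpleGraph V}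

lemma IsPathDecomp.exists_mem_support {t : ℕ} {X : Fin t → Finset V} (hX : IsPathDecomp G t X)
    {u v : V} (w : G.Walk u v) {i j k : Fin t} (hij : i ≤ j) (hjk : j ≤ k)
    (hu : u ∈ X i) (hv : v ∈ X k) : ∃ x ∈ w.support, x ∈ X j := by
  induction w generalizing i with
  | nil => exact ⟨_, by simp, hX.2.2 _ i j k hij hjk hu hv⟩
  | cons h p ih =>
    obtain ⟨l, hul, hcl⟩ := hX.2.1 h
    obtain hl | hl := le_total j l
    · exact ⟨_, by simp, hX.2.2 _ i j l hij hl hu hul⟩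
    · obtain ⟨x, hx, hxj⟩ := ih hl hcl hv
      exact ⟨x, by simp [hx], hxj⟩

lemma exists_spine (hG : G.Connected) (hpw : pathwidthLE G 1) :
    ∃ (a b : V) (p : G.Walk a b), p.IsPath ∧
      ∀ v ∉ p.support, ∀ u, G.Adj v u → u ∈ p.support := by
  classical
  obtain ⟨t, X, hX, hcard⟩ := hpw
  obtain ⟨v₀⟩ := hG.nonempty
  obtain ⟨i₀, hi₀⟩ := hX.1 v₀
  have hne : (Finset.univ.filter fun i => (X i).Nonempty).Nonempty :=
    ⟨i₀, by simpa using ⟨v₀, hi₀⟩⟩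
  obtain ⟨i, hi, hmin⟩ := Finset.exists_min_image _ id hne
  obtain ⟨k, hk, hmax⟩ := Finset.exists_max_image _ id hne
  simp only [Finset.mem_filter, Finset.mem_univ, true_and, id] at hi hk hmin hmax
  obtain ⟨a, ha⟩ := hi
  obtain ⟨b, hb⟩ := hk
  obtain ⟨p, hp⟩ := hG.exists_isPath a b
  refine ⟨a, b, p, hp, fun v hv u huv => ?_⟩
  obtain ⟨j, hvj, huj⟩ := hX.2.1 huv
  obtain ⟨x, hx, hxj⟩ := hX.exists_mem_support p (hmin j ⟨v, hvj⟩) (hmax j ⟨v, hvj⟩) ha hb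
  have hvx : v ≠ x := by rintro rfl; exact hv hx
  by_contra hu
  have hux : u ≠ x := by rintro rfl; exact hu hx
  have h3 : ({v, u, x} : Finset V).card = 3 := Finset.card_eq_three.2
    ⟨v, u, x, huv.ne, hvx, hux, rfl⟩
  have hsub : ({v, u, x} : Finset V) ⊆ X j := by
    intro y; simp only [Finset.mem_insert, Finset.mem_singleton]
    rintro (rfl | rfl | rfl) <;> assumption
  have := Finset.card_le_card hsub
  have := hcard j
  omega

lemma eq_of_adj_of_notMem_support (hG : G.IsTree) {a b v x y : V} (p : G.Walk a b)
    (hv : v ∉ p.support) (hx : x ∈ p.support) (hy : y ∈ p.support)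
    (hvx : G.Adj v x) (hvy : G.Adj v y) : x = y := by
  classical
  by_contra hxy
  let q : G.Walk x y := (p.takeUntil x hx).reverse.append (p.takeUntil y hy)
  have hq : v ∉ q.bypass.support := fun h => by
    have h := q.support_bypass_subset_support h
    simp only [q, SimpleGraph.Walk.mem_support_append_iff, SimpleGraph.Walk.support_reverse,
      List.mem_reverse] at h
    exact hv (h.elim (fun h => p.support_takeUntil_subset_support hx h)
      (fun h => p.support_takeUntil_subset_support hy h))
  let r : G.Walk x y := .cons hvx.symm (.cons hvy .nil)
  have hr : r.IsPath := by
    simp [r, SimpleGraph.Walk.cons_isPath_iff, hvx.ne', hvy.ne, hxy]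
  have hqr : q.bypass = r :=
    congrArg Subtype.val ((hG.isAcyclic.subsingleton_path _ _).elim ⟨q.bypass, q.bypass_isPath⟩
      ⟨r, hr⟩)
  rw [hqr] at hq
  simp [r] at hq

/-- A metric tree of pathwidth at most one is a caterpillar: `f` is the position of (the foot of)
a vertex along the spine, and `h` is its distance from the spine. -/
theorem exists_caterpillar_coordinates {len : Sym2 V → ℝ} (hG : G.IsTree)
    (hpw : pathwidthLE G 1) (hlen : ∀ e, 0 ≤ len e) :
    ∃ f h : V → ℝ, (∀ u v, |f u - f v| ≤ spDist G len u v) ∧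
      (∀ u v, u ≠ v → h u ≤ spDist G len u v) ∧
      ∀ u v, spDist G len u v ≤ |f u - f v| + h u + h v := by
  classical
  obtain ⟨a, b, p, hp, hspine⟩ := exists_spine hG.1 hpw
  have hfoot : ∀ v, ∃ x ∈ p.support,
      (v ∈ p.support → x = v) ∧ (v ∉ p.support → ∀ u, G.Adj v u → u = x) := by
    intro v
    by_cases hv : v ∈ p.support
    · exact ⟨v, hv, fun _ => rfl, fun h => absurd hv h⟩
    · obtain ⟨w⟩ := hG.1 v a
      cases w with
      | nil => exact absurd p.start_mem_support hv
      | cons h _ =>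
        exact ⟨_, hspine v hv _ h, fun h => absurd h hv, fun _ u hu =>
          eq_of_adj_of_notMem_support hG p hv (hspine v hv _ hu) (hspine v hv _ h) hu h⟩
  choose π hπ hπ_on hπ_off using hfoot
  have hπ_off' : ∀ u v, u ∉ p.support → G.Adj u v → π u = π v := fun u v hu huv => by
    rw [hπ_on v (hspine u hu v huv), hπ_off u hu v huv]
  refine ⟨fun v => spDist G len a (π v), fun v => spDist G len v (π v), ?_, ?_, ?_⟩
  · refine abs_sub_le_spDist hG.1 fun u v huv => ?_
    by_cases hu : u ∈ p.support
    · by_cases hv : v ∈ p.support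
      · rw [hπ_on u hu, hπ_on v hv, abs_sub_le_iff]
        have h1 := spDist_triangle hG.1 hlen a u v
        have h2 := spDist_triangle hG.1 hlen a v u
        have h3 := spDist_le_of_adj hlen huv
        rw [spDist_comm hG.1 hlen v u] at h2
        constructor <;> linarith
      · simpa [hπ_off' v u hv huv.symm] using hlen _
    · simpa [hπ_off' u v hu huv] using hlen _
  · intro u v huv
    by_cases hu : u ∈ p.support
    · simpa only [hπ_on u hu, spDist_self hlen] using spDist_nonneg hlen u v
    · refine le_spDist hG.1 fun w => ?_
      cases w with
      | nil => exact absurd rfl huv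
      | cons h q =>
        have h1 := spDist_le_of_adj hlen h
        have h2 := walk_weight_nonneg hlen q
        simp only [← hπ_off u hu _ h, SimpleGraph.Walk.edges_cons, List.map_cons, List.sum_cons]
        linarith
  · intro u v
    have h1 := spDist_triangle hG.1 hlen u (π u) v
    have h2 := spDist_triangle hG.1 hlen (π u) (π v) v
    have h3 := spDist_le_abs_sub_of_mem_support hG hlen hp (hπ u) (hπ v)
    rw [spDist_comm hG.1 hlen (π v) v] at h2
    linarith

end Caterpillar

section Spider

variable {m : ℝ} {l : ℕ}

/-- The vertex at distance `k` from the root on the `j`-th leg of `Ψ_{1,m,l}`; it is a junk value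
unless `k ≤ sc m`. -/
noncomputable def spiderVertex (m : ℝ) (l : ℕ) (j : Fin l) : ℕ → Option (PsiC 1 m l)
  | 0 => none
  | k + 1 => if h : k < sc m then some (Sum.inl (j, ⟨k, h⟩)) else none

lemma psiRel_one_iff {u v : Option (PsiC 1 m l)} :
    PsiRel 1 m l u v ↔
      ∃ (j : Fin l) (k : Fin (sc m)), u = spiderVertex m l j k ∧ v = some (Sum.inl (j, k)) := by
  constructor
  · intro h
    obtain _ | ⟨⟨i, p⟩ | ⟨_, ⟨⟩⟩⟩ := u
    · obtain _ | ⟨⟨j, q⟩ | ⟨_, ⟨⟩⟩⟩ := v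
      · exact h.elim
      · have h : (q : ℕ) = 0 := h
        exact ⟨j, q, by rw [h]; rfl, rfl⟩
    · obtain _ | ⟨⟨j, q⟩ | ⟨_, ⟨⟩⟩⟩ := v
      · exact h.elim
      · obtain ⟨rfl, h⟩ : i = j ∧ (p : ℕ) + 1 = (q : ℕ) := h
        refine ⟨i, q, ?_, rfl⟩
        rw [← h, spiderVertex, dif_pos p.2]
  · rintro ⟨j, ⟨k, hk⟩, rfl, rfl⟩
    cases k with
    | zero => exact rfl
    | succ k =>
      simp only [spiderVertex, dif_pos (Nat.lt_of_succ_lt hk)]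
      exact ⟨rfl, rfl⟩

/-- The non-root vertices of `Ψ_{1,m,l}` are the positions on its legs. -/
def psiOneEquiv (m : ℝ) (l : ℕ) : Fin l × Fin (sc m) ≃ PsiC 1 m l where
  toFun x := Sum.inl x
  invFun x := match x with
    | Sum.inl x => x
    | Sum.inr (_, c) => nomatch c
  left_inv _ := rfl
  right_inv x := by
    obtain x | ⟨_, ⟨⟩⟩ := x
    rfl

lemma spiderVertex_succ (j : Fin l) (k : Fin (sc m)) :
    spiderVertex m l j (k + 1) = some (Sum.inl (j, k)) :=
  dif_pos k.2

lemma psiRel_spiderVertex (j : Fin l) {k : ℕ} (hk : k < sc m) :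
    PsiRel 1 m l (spiderVertex m l j k) (spiderVertex m l j (k + 1)) :=
  psiRel_one_iff.2 ⟨j, ⟨k, hk⟩, rfl, spiderVertex_succ j ⟨k, hk⟩⟩

/-- The signed distance to the root of `Ψ_{1,m,l}`, positive on the `j`-th leg and negative on
all the others. -/
noncomputable def signedDepth (j : Fin l) (v : Option (PsiC 1 m l)) : ℤ :=
  v.elim 0 fun c =>
    let x := (psiOneEquiv m l).symm c
    if x.1 = j then (x.2 : ℤ) + 1 else -((x.2 : ℤ) + 1)

lemma signedDepth_spiderVertex (i j : Fin l) {k : ℕ} (hk : k ≤ sc m) :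
    signedDepth j (spiderVertex m l i k) = if i = j then (k : ℤ) else -(k : ℤ) := by
  cases k with
  | zero => simp [spiderVertex, signedDepth]
  | succ k =>
    rw [spiderVertex_succ i ⟨k, hk⟩]
    change (if i = j then (k : ℤ) + 1 else -((k : ℤ) + 1)) = _
    push_cast
    rfl

lemma signedDepth_sub_of_psiRel (j : Fin l) {u v : Option (PsiC 1 m l)} (h : PsiRel 1 m l u v) :
    |signedDepth j u - signedDepth j v| = 1 := by
  obtain ⟨i, k, rfl, rfl⟩ := psiRel_one_iff.1 h
  rw [← spiderVertex_succ, signedDepth_spiderVertex i j k.2.le,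
    signedDepth_spiderVertex i j (Nat.succ_le_of_lt k.2)]
  split_ifs <;> simp

lemma psiRel_ne {u v : Option (PsiC 1 m l)} (h : PsiRel 1 m l u v) : u ≠ v := by
  rintro rfl
  obtain ⟨j, -⟩ := psiRel_one_iff.1 h
  simpa using signedDepth_sub_of_psiRel j h

lemma psiRel_asymm {u v : Option (PsiC 1 m l)} (h : PsiRel 1 m l u v) : ¬ PsiRel 1 m l v u := by
  intro h'
  obtain ⟨j, k, hu, hv⟩ := psiRel_one_iff.1 h
  obtain ⟨i, q, hv', hu'⟩ := psiRel_one_iff.1 h'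
  rw [← spiderVertex_succ] at hv hu'
  have h1 := congrArg (signedDepth j) (hu.symm.trans hu')
  have h2 := congrArg (signedDepth j) (hv.symm.trans hv')
  rw [signedDepth_spiderVertex _ j k.2.le, signedDepth_spiderVertex _ j (Nat.succ_le_of_lt q.2)]
    at h1
  rw [signedDepth_spiderVertex _ j q.2.le, signedDepth_spiderVertex _ j (Nat.succ_le_of_lt k.2)]
    at h2
  split_ifs at h1 h2 <;> push_cast at h1 h2 <;> omega

lemma psiGraph_adj_iff {u v : Option (PsiC 1 m l)} :
    (PsiGraph 1 m l).Adj u v ↔ PsiRel 1 m l u v ∨ PsiRel 1 m l v u := by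
  rw [PsiGraph, SimpleGraph.fromRel_adj]
  exact ⟨And.right, fun h => ⟨h.elim psiRel_ne fun h => (psiRel_ne h).symm, h⟩⟩

lemma psiGraph_reachable_spiderVertex (j : Fin l) {k : ℕ} (hk : k ≤ sc m) :
    (PsiGraph 1 m l).Reachable none (spiderVertex m l j k) := by
  induction k with
  | zero => exact .refl _
  | succ k ih =>
    exact (ih (Nat.le_of_succ_le hk)).trans
      (psiGraph_adj_iff.2 (.inl (psiRel_spiderVertex j hk))).reachable

lemma le_psiGraph_dist {i j : Fin l} (hij : i ≠ j) {p q : ℕ} (hp : p ≤ sc m) (hq : q ≤ sc m) :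
    p + q ≤ (PsiGraph 1 m l).dist (spiderVertex m l i p) (spiderVertex m l j q) := by
  obtain ⟨w, hw⟩ := ((psiGraph_reachable_spiderVertex i hp).symm.trans
    (psiGraph_reachable_spiderVertex j hq)).exists_walk_length_eq_dist
  have key : ∀ {u v : Option (PsiC 1 m l)} (w : (PsiGraph 1 m l).Walk u v),
      |signedDepth i u - signedDepth i v| ≤ w.length := by
    intro u v w
    induction w with
    | nil => simp
    | cons h _ ih =>
      have h1 := (psiGraph_adj_iff.1 h).elim (signedDepth_sub_of_psiRel i)
        fun h => (abs_sub_comm _ _).trans (signedDepth_sub_of_psiRel i h)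
      have h2 := abs_sub_le (signedDepth i _) (signedDepth i _) (signedDepth i _) |>.trans
        (add_le_add h1.le ih)
      rw [SimpleGraph.Walk.length_cons]
      push_cast
      linarith
  have h := (le_abs_self _).trans (key w)
  rw [signedDepth_spiderVertex _ _ hp, signedDepth_spiderVertex _ _ hq, if_pos rfl,
    if_neg hij.symm, hw] at h
  omega

lemma edgeSum_psiGraph_one {f : Option (PsiC 1 m l) → Option (PsiC 1 m l) → ℝ}
    (hf : ∀ u v, f u v = f v u) :
    edgeSum (PsiGraph 1 m l) f = ∑ j : Fin l, ∑ k ∈ Finset.range (sc m),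
      f (spiderVertex m l j k) (spiderVertex m l j (k + 1)) := by
  classical
  have h1 : ∀ u v, (if (PsiGraph 1 m l).Adj u v then f u v else 0) =
      (if PsiRel 1 m l u v then f u v else 0) + if PsiRel 1 m l v u then f v u else 0 := by
    intro u v
    by_cases h : PsiRel 1 m l u v
    · simp [psiGraph_adj_iff, h, psiRel_asymm h]
    · simp [psiGraph_adj_iff, h, hf u v]
  have h2 : ∀ j k, ∑ u, (if PsiRel 1 m l u (some (psiOneEquiv m l (j, k)))
      then f u (some (psiOneEquiv m l (j, k))) else 0) =
      f (spiderVertex m l j k) (spiderVertex m l j (k + 1)) := by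
    intro j k
    rw [Finset.sum_eq_single (spiderVertex m l j k), if_pos, spiderVertex_succ]
    · rfl
    · exact psiRel_one_iff.2 ⟨j, k, rfl, rfl⟩
    · intro u _ hu
      refine if_neg fun h => hu ?_
      obtain ⟨j', k', rfl, hjk⟩ := psiRel_one_iff.1 h
      cases (psiOneEquiv m l).injective
        (a₁ := (j, k)) (a₂ := (j', k')) (Option.some_injective _ hjk)
      rfl
    · simp
  have h3 : ∑ v, ∑ u, (if PsiRel 1 m l u v then f u v else 0) =
      ∑ j : Fin l, ∑ k ∈ Finset.range (sc m),
        f (spiderVertex m l j k) (spiderVertex m l j (k + 1)) := by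
    rw [Fintype.sum_option, ← (psiOneEquiv m l).sum_comp, Fintype.sum_prod_type]
    simp_rw [h2]
    rw [Finset.sum_eq_zero, zero_add]
    · exact Finset.sum_congr rfl fun j _ => (Finset.sum_range fun k =>
        f (spiderVertex m l j k) (spiderVertex m l j (k + 1))).symm
    · intro u _
      refine if_neg fun h => ?_
      obtain ⟨j, k, -, h⟩ := psiRel_one_iff.1 h
      cases h
  unfold edgeSum
  rw [← h3]
  simp only [h1, Finset.sum_add_distrib]
  rw [Finset.sum_comm (f := fun u v => if PsiRel 1 m l u v then f u v else 0)]
  ring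

lemma numEdges_psiGraph_one : numEdges (PsiGraph 1 m l) = l * sc m := by
  have h := edgeSum_psiGraph_one (m := m) (l := l) (f := fun _ _ => 1) fun _ _ => rfl
  simpa [edgeSum, numEdges] using h

end Spider

section Packing

lemma card_le_of_one_le_abs_sub {ι : Type*} {A : Finset ι} {x : ι → ℝ} {c : ℝ} (hc : 0 ≤ c)
    (hx : ∀ i ∈ A, |x i| ≤ c) (hsep : ∀ i ∈ A, ∀ j ∈ A, i ≠ j → 1 ≤ |x i - x j|) :
    (A.card : ℝ) ≤ 2 * c + 2 := by
  have hcard : A.card ≤ (Finset.Icc ⌊-c⌋ ⌊c⌋).card := by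
    refine Finset.card_le_card_of_injOn (fun i => ⌊x i⌋) (fun i hi => ?_) fun i hi j hj hij => ?_
    · have := abs_le.1 (hx i hi)
      simpa using ⟨Int.floor_mono this.1, Int.floor_mono this.2⟩
    · by_contra hne
      exact (hsep i hi j hj hne).not_gt (Int.abs_sub_lt_one_of_floor_eq_floor hij)
  have h0 : ⌊-c⌋ ≤ ⌊c⌋ := Int.floor_mono (by linarith)
  have h1 : ((⌊c⌋ + 1 - ⌊-c⌋).toNat : ℝ) = ⌊c⌋ + 1 - ⌊-c⌋ := by
    have : ((⌊c⌋ + 1 - ⌊-c⌋).toNat : ℤ) = ⌊c⌋ + 1 - ⌊-c⌋ := Int.toNat_of_nonneg (by omega)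
    exact_mod_cast this
  rw [Int.card_Icc] at hcard
  have h2 : (A.card : ℝ) ≤ ((⌊c⌋ + 1 - ⌊-c⌋).toNat : ℝ) := by exact_mod_cast hcard
  have h3 := Int.floor_le c
  have h4 := Int.sub_one_lt_floor (-c)
  linarith

/-- An embedding of a spider with `l` legs of length `n` into a caterpillar cannot have small
average stretch. Here `F j k` and `H j k` are the coordinates of the image of the `k`-th vertex
of the `j`-th leg, `D j k` is the stretch of the `k`-th edge of that leg, and `hsep` says that the
embedding does not contract distances between vertices of different legs. -/
lemma le_sum_stretch_of_caterpillar_coordinates {n l : ℕ} {s : ℝ} (hs : 2 ^ 10 ≤ s)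
    (hn : s ≤ n) (hl : s / 2 ≤ l) {F H D : Fin l → ℕ → ℝ} {F₀ : ℝ} (hF₀ : ∀ j, F j 0 = F₀)
    (hD : ∀ j, ∀ k < n, |F j k - F j (k + 1)| ≤ D j k)
    (hH : ∀ j, ∀ k < n, H j (k + 1) ≤ D j k)
    (hsep : ∀ i j, i ≠ j → ∀ p ≤ n, ∀ q ≤ n, ((p + q : ℕ) : ℝ) ≤ |F i p - F j q| + H i p + H j q) :
    s / 2 ^ 10 * (l * n) ≤ ∑ j, ∑ k ∈ Finset.range n, D j k := by
  by_contra! hlt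
  have hD0 : ∀ j, ∀ k < n, 0 ≤ D j k := fun j k hk => (abs_nonneg _).trans (hD j k hk)
  have hn0 : (0 : ℝ) < n := by linarith
  set S : Fin l → ℝ := fun j => ∑ k ∈ Finset.range n, D j k with hS
  have hS0 : ∀ j, 0 ≤ S j := fun j => Finset.sum_nonneg fun k hk => hD0 j k (Finset.mem_range.1 hk)
  set A : Finset (Fin l) := Finset.univ.filter fun j => S j ≤ s * n / 256 with hA
  have hAcard : 3 / 4 * (l : ℝ) ≤ A.card := by
    have h1 : (Aᶜ.card : ℝ) * (s * n / 256) ≤ ∑ j, S j := by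
      rw [← nsmul_eq_mul]
      refine (Finset.card_nsmul_le_sum Aᶜ S _ fun j hj => ?_).trans
        (Finset.sum_le_sum_of_subset_of_nonneg (Finset.subset_univ _) fun j _ _ => hS0 j)
      simp only [hA, Finset.mem_compl, Finset.mem_filter, Finset.mem_univ, true_and, not_le] at hj
      exact hj.le
    have h2 : (A.card : ℝ) + Aᶜ.card = l := by
      have := A.card_add_card_compl
      rw [Fintype.card_fin] at this
      exact_mod_cast this
    have h3 : (Aᶜ.card : ℝ) * (s * n) < l / 4 * (s * n) := by linarith
    have h4 := lt_of_mul_lt_mul_right h3 (by positivity)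
    linarith
  have hchoose : ∀ j ∈ A, ∃ k < n, (n : ℝ) / 2 ≤ ((k + 1 : ℕ) : ℝ) ∧ H j (k + 1) ≤ s / 128 := by
    intro j hj
    have hnpos : 0 < n := by exact_mod_cast hn0
    have hhalf : (n : ℝ) / 2 ≤ ((n - n / 2 : ℕ) : ℝ) := by
      have : n ≤ 2 * (n - n / 2) := by omega
      have : (n : ℝ) ≤ 2 * ((n - n / 2 : ℕ) : ℝ) := by exact_mod_cast this
      linarith
    have hle : ∑ k ∈ Finset.Ico (n / 2) n, D j k ≤ ∑ _k ∈ Finset.Ico (n / 2) n, s / 128 := by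
      have h1 : ∑ k ∈ Finset.Ico (n / 2) n, D j k ≤ S j :=
        Finset.sum_le_sum_of_subset_of_nonneg
          (fun k hk => Finset.mem_range.2 (Finset.mem_Ico.1 hk).2)
          fun k hk _ => hD0 j k (Finset.mem_range.1 hk)
      have h2 := (Finset.mem_filter.1 hj).2
      rw [Finset.sum_const, Nat.card_Ico, nsmul_eq_mul]
      have h3 := mul_le_mul_of_nonneg_right hhalf (show 0 ≤ s / 128 by positivity)
      linarith
    obtain ⟨k, hk, hkD⟩ := Finset.exists_le_of_sum_le
      (Finset.nonempty_Ico.2 (Nat.div_lt_self hnpos one_lt_two)) hle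
    rw [Finset.mem_Ico] at hk
    refine ⟨k, hk.2, ?_, (hH j k hk.2).trans hkD⟩
    have : n ≤ 2 * (k + 1) := by omega
    have : (n : ℝ) ≤ 2 * ((k + 1 : ℕ) : ℝ) := by exact_mod_cast this
    linarith
  choose! κ hκn hκ hκH using hchoose
  have hbound : ∀ j ∈ A, |F j (κ j + 1) - F₀| ≤ s * n / 256 := by
    intro j hj
    have h1 : ∀ k ≤ n, |F j k - F₀| ≤ ∑ i ∈ Finset.range k, D j i := by
      intro k
      induction k with
      | zero => simp [hF₀]
      | succ k ih =>
        intro hk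
        rw [Finset.sum_range_succ]
        have h2 := ih (Nat.le_of_succ_le hk)
        have h3 := hD j k hk
        rw [abs_sub_comm] at h3
        have h4 := abs_sub_le (F j (k + 1)) (F j k) F₀
        linarith
    refine (h1 _ (hκn j hj)).trans (le_trans ?_ (Finset.mem_filter.1 hj).2)
    exact Finset.sum_le_sum_of_subset_of_nonneg (Finset.range_mono (hκn j hj))
      fun k hk _ => hD0 j k (Finset.mem_range.1 hk)
  have hpack := card_le_of_one_le_abs_sub (A := A) (c := s / 128)
    (x := fun j => (F j (κ j + 1) - F₀) / (n / 2)) (by positivity)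
    (fun j hj => by
      rw [abs_div, abs_of_pos (half_pos hn0), div_le_iff₀ (half_pos hn0)]
      linarith [hbound j hj])
    (fun i hi j hj hij => by
      rw [← sub_div, abs_div, abs_of_pos (half_pos hn0), one_le_div (half_pos hn0),
        sub_sub_sub_cancel_right]
      have h := hsep i j hij (κ i + 1) (hκn i hi) (κ j + 1) (hκn j hj)
      rw [Nat.cast_add] at h
      linarith [hκ i hi, hκ j hj, hκH i hi, hκH j hj])
  linarith

end Packing

/-- **Lemma (base case of the lower bound).** Let `g` be a non-contractive embedding of the
unit-weighted tree `Ψ_{1,m,√m/2}` into a metric tree `T` of pathwidth one.  Then the average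
stretch over the edges is at least `√m / 2^10`. -/
theorem lower_bound_base_case (m : ℝ) {W : Type} [Fintype W]
    (T : SimpleGraph W) (hT : T.IsTree) (hpw : pathwidth T = 1)
    (len : Sym2 W → ℝ) (hlen : ∀ e, 0 ≤ len e)
    (g : Option (PsiC 1 m ⌈Real.sqrt m / 2⌉₊) → W)
    (hg : ∀ u v, ((PsiGraph 1 m ⌈Real.sqrt m / 2⌉₊).dist u v : ℝ) ≤ spDist T len (g u) (g v)) :
    Real.sqrt m / 2 ^ 10 ≤
      edgeSum (PsiGraph 1 m ⌈Real.sqrt m / 2⌉₊) (fun u v => spDist T len (g u) (g v)) /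
        numEdges (PsiGraph 1 m ⌈Real.sqrt m / 2⌉₊) := by
  have hsc : Real.sqrt m ≤ (sc m : ℝ) := Nat.le_ceil _
  have hl : Real.sqrt m / 2 ≤ (⌈Real.sqrt m / 2⌉₊ : ℝ) := Nat.le_ceil _
  revert g
  generalize ⌈Real.sqrt m / 2⌉₊ = l at hl ⊢
  intro g hg
  have hpw' : pathwidthLE T 1 := by
    have hne : {k | pathwidthLE T k}.Nonempty := by
      by_contra hne
      rw [Set.not_nonempty_iff_eq_empty] at hne
      simp [pathwidth, hne] at hpw
    have := Nat.sInf_mem hne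
    rwa [← pathwidth, hpw] at this
  rw [edgeSum_psiGraph_one fun u v => spDist_comm hT.1 hlen _ _, numEdges_psiGraph_one]
  obtain hs0 | hs0 := (Real.sqrt_nonneg m).eq_or_lt
  · rw [← hs0, zero_div]
    exact div_nonneg (Finset.sum_nonneg fun _ _ => Finset.sum_nonneg fun _ _ =>
      spDist_nonneg hlen _ _) (by positivity)
  have hadj : ∀ (j : Fin l), ∀ k < sc m, 1 ≤ spDist T len
      (g (spiderVertex m l j k)) (g (spiderVertex m l j (k + 1))) := by
    intro j k hk
    have h := hg (spiderVertex m l j k) (spiderVertex m l j (k + 1))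
    rwa [SimpleGraph.dist_eq_one_iff_adj.2 (psiGraph_adj_iff.2 (.inl (psiRel_spiderVertex j hk))),
      Nat.cast_one] at h
  rw [le_div_iff₀ (mul_pos (by linarith) (by linarith))]
  obtain hsmall | hlarge := le_total (Real.sqrt m) (2 ^ 10)
  · calc Real.sqrt m / 2 ^ 10 * (l * sc m) ≤ 1 * (l * sc m) := by
          gcongr
          exact div_le_one_of_le₀ hsmall (by positivity)
      _ = ∑ _j : Fin l, ∑ _k ∈ Finset.range (sc m), (1 : ℝ) := by simp
      _ ≤ _ := Finset.sum_le_sum fun j _ => Finset.sum_le_sum fun k hk =>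
          hadj j k (Finset.mem_range.1 hk)
  · obtain ⟨f, h, hf, hh, hfh⟩ := exists_caterpillar_coordinates hT hpw' hlen
    refine le_sum_stretch_of_caterpillar_coordinates hlarge hsc hl
      (F := fun j k => f (g (spiderVertex m l j k)))
      (H := fun j k => h (g (spiderVertex m l j k))) (F₀ := f (g none)) (fun _ => rfl)
      (fun j k _ => hf _ _) (fun j k hk => ?_) fun i j hij p hp q hq => ?_
    · rw [spDist_comm hT.1 hlen]
      refine hh _ _ fun heq => ?_
      have := hadj j k hk
      rw [heq, spDist_self hlen] at this
      linarith
    · exact le_trans (Nat.cast_le.2 (le_psiGraph_dist hij hp hq)) ((hg _ _).trans (hfh _ _))
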